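/- Let U = [[A_U, B_U],[C_U, D_U]] and V = [[A_V, B_V],[C_V, D_V]] be complex block matrices with blocks of matching sizes. Suppose R(C_Uᴴ) ⊆ R(A_Uᴴ), R(B_U) ⊆ R(A_U), R(B_Uᴴ) ⊆ R(D_Uᴴ), R(C_U) ⊆ R(D_U), R(C_Vᴴ) ⊆ R(A_Vᴴ), R(B_V) ⊆ R(A_V), R(B_Vᴴ) ⊆ R(D_Vᴴ) and R(C_V) ⊆ R(D_V), and suppose D_U and D_V are range symmetric. If (U, V) is a Moore-Penrose inverse absorbing pair, then (J_U, J_V) is also a Moore-Penrose inverse absorbing pair, where J_U = [[G_U, B_U D_U⁺],[−D_U⁺ C_U, D_U⁺]] with G_U = A_U − B_U D_U⁺ C_U, and J_V = [[G_V, B_V D_V⁺],[−D_V⁺ C_V, D_V⁺]] with G_V = A_V − B_V D_V⁺ C_V. -/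

import Mathlib

open Matrix

/-- `X` is the Moore-Penrose inverse of `A`. -/
def IsMoorePenrose {m n : Type*} [Fintype m] [Fintype n]
    (A : Matrix m n ℂ) (X : Matrix n m ℂ) : Prop :=
  A * X * A = A ∧ X * A * X = X ∧ (A * X)ᴴ = A * X ∧ (X * A)ᴴ = X * A

/-- The column space (range) of a complex matrix. -/
noncomputable def colSpace {m n : Type*} [Fintype n] (A : Matrix m n ℂ) :
    Submodule ℂ (m → ℂ) :=
  LinearMap.range A.mulVecLin

/-- Inclusion of column spaces is divisibility from the left. -/
theorem exists_eq_mul_of_colSpace_le {l m n : Type*} [Fintype m] [DecidableEq m] [Fintype n]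
    {A : Matrix l m ℂ} {B : Matrix l n ℂ} (h : colSpace A ≤ colSpace B) :
    ∃ K : Matrix n m ℂ, A = B * K := by
  have hcol : ∀ j, ∃ v : n → ℂ, B *ᵥ v = A.col j := fun j =>
    h ⟨Pi.single j 1, by simp⟩
  choose v hv using hcol
  refine ⟨Matrix.of fun i j => v j i, ?_⟩
  ext i j
  exact (congrFun (hv j) i).symm

theorem exists_eq_mul_of_colSpace_conjTranspose_le {l m n : Type*} [Fintype l] [Fintype m]
    [DecidableEq m] {A : Matrix m n ℂ} {B : Matrix l n ℂ}
    (h : colSpace Aᴴ ≤ colSpace Bᴴ) : ∃ K : Matrix m l ℂ, A = K * B := by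
  obtain ⟨K, hK⟩ := exists_eq_mul_of_colSpace_le h
  exact ⟨Kᴴ, by simpa using congrArg conjTranspose hK⟩

/-- A pair is Moore-Penrose inverse absorbing exactly when the column space of the
first lies in that of the second and the row space of the second lies in that of the first. -/
theorem IsMoorePenrose.absorbing_iff {m n : Type*} [Fintype m] [Fintype n]
    {A B : Matrix m n ℂ} {X Y : Matrix n m ℂ}
    (hA : IsMoorePenrose A X) (hB : IsMoorePenrose B Y) :
    X + Y = X * (A + B) * Y ↔ B * Y * A = A ∧ B * X * A = B := by
  obtain ⟨a1, a2, a3, a4⟩ := hA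
  obtain ⟨b1, b2, b3, b4⟩ := hB
  constructor
  · intro h
    have h1 : A * X = A * X * (B * Y) := by
      have := congrArg (A * ·) h
      simp only [Matrix.mul_add, Matrix.add_mul, ← Matrix.mul_assoc, a1] at this
      rw [add_comm] at this
      simpa only [Matrix.mul_assoc] using add_left_cancel this
    have h2 : Y = X * A * Y := by
      have hX : X = X * B * Y := by
        have := congrArg (X * ·) h1
        simpa only [← Matrix.mul_assoc, a2] using this
      rw [Matrix.mul_add, Matrix.add_mul, ← hX, add_comm] at h
      exact add_right_cancel h
    constructor
    · have h3 : A * X = B * Y * (A * X) := by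
        have := congrArg Matrix.conjTranspose h1
        rwa [conjTranspose_mul (A * X), a3, b3] at this
      calc B * Y * A = B * Y * (A * X) * A := by
            simp only [Matrix.mul_assoc] at a1 ⊢
            rw [a1]
        _ = A := by rw [← h3, a1]
    · have h3 : Y * B = Y * B * (X * A) := by
        have : Y * B = X * A * (Y * B) := by rw [← Matrix.mul_assoc, ← h2]
        have := congrArg conjTranspose this
        rwa [conjTranspose_mul (X * A), a4, b4] at this
      calc B * X * A = B * (Y * B * (X * A)) := by
            simp only [← Matrix.mul_assoc, b1]
        _ = B := by rw [← h3, ← Matrix.mul_assoc, b1]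
  · rintro ⟨h1, h2⟩
    have h3 : A * X * (B * Y) = A * X := by
      have : B * Y * (A * X) = A * X := by rw [← Matrix.mul_assoc, h1]
      have := congrArg conjTranspose this
      rwa [conjTranspose_mul, a3, b3] at this
    have h4 : X * A * (Y * B) = Y * B := by
      have : Y * B * (X * A) = Y * B := by
        rw [Matrix.mul_assoc, ← Matrix.mul_assoc B, h2]
      have := congrArg conjTranspose this
      rwa [conjTranspose_mul, a4, b4] at this
    have h5 : X * B * Y = X := by
      calc X * B * Y = X * (A * X * (B * Y)) := by
            simp only [← Matrix.mul_assoc, a2]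
        _ = X := by rw [h3, ← Matrix.mul_assoc, a2]
    have h6 : X * A * Y = Y := by
      calc X * A * Y = X * A * (Y * B) * Y := by
            simp only [Matrix.mul_assoc] at b2 ⊢
            rw [b2]
        _ = Y := by rw [h4, b2]
    rw [Matrix.mul_add, Matrix.add_mul, h5, h6, add_comm]

theorem IsMoorePenrose.absorbing_of_eq_mul {m n : Type*} [Fintype m] [Fintype n]
    {A B : Matrix m n ℂ} {X Y : Matrix n m ℂ}
    (hA : IsMoorePenrose A X) (hB : IsMoorePenrose B Y)
    {Z : Matrix n n ℂ} {W : Matrix m m ℂ} (hZ : A = B * Z) (hW : B = W * A) :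
    X + Y = X * (A + B) * Y := by
  refine (hA.absorbing_iff hB).2 ⟨?_, ?_⟩
  · conv_lhs => rw [hZ, ← Matrix.mul_assoc, hB.1]
    exact hZ.symm
  · conv_lhs => rw [hW, Matrix.mul_assoc, Matrix.mul_assoc, ← Matrix.mul_assoc A, hA.1]
    exact hW.symm

/-- For range symmetric matrices, inclusion of column spaces passes to Moore-Penrose inverses. -/
theorem IsMoorePenrose.exists_eq_mul_of_rangeSymmetric {n : Type*} [Fintype n] [DecidableEq n]
    {D E X Y T : Matrix n n ℂ} (hD : IsMoorePenrose D X) (hE : IsMoorePenrose E Y)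
    (hrD : colSpace Dᴴ = colSpace D) (hrE : colSpace Eᴴ = colSpace E) (h : D = E * T) :
    ∃ Z, X = Y * Z := by
  obtain ⟨R, hR⟩ := exists_eq_mul_of_colSpace_le hrD.le
  obtain ⟨S, hS⟩ := exists_eq_mul_of_colSpace_le hrE.ge
  have hX : X = Dᴴ * (Xᴴ * X) := by
    rw [← Matrix.mul_assoc, ← conjTranspose_mul, hD.2.2.2, hD.2.1]
  have hEH : Eᴴ = Y * (E * Eᴴ) := by
    rw [← Matrix.mul_assoc]
    conv_rhs => rw [← hE.2.2.2, ← conjTranspose_mul, ← Matrix.mul_assoc, hE.1]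
  refine ⟨E * Eᴴ * (S * (T * (R * (Xᴴ * X)))), ?_⟩
  rw [← Matrix.mul_assoc, ← hEH, ← Matrix.mul_assoc, ← hS, ← Matrix.mul_assoc, ← h,
    ← Matrix.mul_assoc, ← hR, ← hX]

theorem IsMoorePenrose.conjTranspose {m n : Type*} [Fintype m] [Fintype n]
    {A : Matrix m n ℂ} {X : Matrix n m ℂ} (h : IsMoorePenrose A X) : IsMoorePenrose Aᴴ Xᴴ := by
  obtain ⟨a1, a2, a3, a4⟩ := h
  refine ⟨?_, ?_, ?_, ?_⟩
  · rw [← conjTranspose_mul, ← conjTranspose_mul, ← Matrix.mul_assoc, a1]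
  · rw [← conjTranspose_mul, ← conjTranspose_mul, ← Matrix.mul_assoc, a2]
  · rw [← conjTranspose_mul, a4, a4]
  · rw [← conjTranspose_mul, a3, a3]

theorem pivot_eq_diag_mul {m n p : Type*} [Fintype n] [DecidableEq n]
    [Fintype p] [DecidableEq p] (A : Matrix m n ℂ) (D : Matrix p p ℂ)
    (K : Matrix n p ℂ) (C : Matrix p n ℂ) :
    fromBlocks (A - A * K * D * C) (A * K * D) (-(D * C)) D =
      fromBlocks A 0 0 D * fromBlocks (1 - K * D * C) (K * D) (-C) 1 := by
  simp [fromBlocks_multiply, Matrix.mul_sub, Matrix.mul_assoc]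

theorem diag_eq_pivot_mul {m n p : Type*} [Fintype n] [DecidableEq n]
    [Fintype p] [DecidableEq p] (A : Matrix m n ℂ) (D : Matrix p p ℂ)
    (K : Matrix n p ℂ) (C : Matrix p n ℂ) :
    fromBlocks A 0 0 D = fromBlocks (A - A * K * D * C) (A * K * D) (-(D * C)) D *
      fromBlocks 1 (-(K * D)) C (1 - C * K * D) := by
  simp [fromBlocks_multiply, Matrix.mul_sub, Matrix.sub_mul, Matrix.mul_assoc]

theorem pivot_eq_mul_diag {m n p : Type*} [Fintype m] [DecidableEq m]
    [Fintype p] [DecidableEq p] (A : Matrix m n ℂ) (D : Matrix p p ℂ)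
    (B : Matrix m p ℂ) (L : Matrix p m ℂ) :
    fromBlocks (A - B * D * (L * A)) (B * D) (-(D * (L * A))) D =
      fromBlocks (1 - B * D * L) B (-(D * L)) 1 * fromBlocks A 0 0 D := by
  simp [fromBlocks_multiply, Matrix.sub_mul, Matrix.mul_assoc]

theorem diag_eq_mul_pivot {m n p : Type*} [Fintype m] [DecidableEq m]
    [Fintype p] [DecidableEq p] (A : Matrix m n ℂ) (D : Matrix p p ℂ)
    (B : Matrix m p ℂ) (L : Matrix p m ℂ) :
    fromBlocks A 0 0 D = fromBlocks 1 (-B) (D * L) (1 - D * L * B) *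
      fromBlocks (A - B * D * (L * A)) (B * D) (-(D * (L * A))) D := by
  simp [fromBlocks_multiply, Matrix.mul_sub, Matrix.sub_mul, Matrix.mul_assoc]

theorem inheritance_cpppt_moore_penrose_absorbing {m n p : ℕ}
    (AU : Matrix (Fin m) (Fin n) ℂ) (BU : Matrix (Fin m) (Fin p) ℂ)
    (CU : Matrix (Fin p) (Fin n) ℂ) (DU : Matrix (Fin p) (Fin p) ℂ)
    (AV : Matrix (Fin m) (Fin n) ℂ) (BV : Matrix (Fin m) (Fin p) ℂ)
    (CV : Matrix (Fin p) (Fin n) ℂ) (DV : Matrix (Fin p) (Fin p) ℂ)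
    (DUp DVp : Matrix (Fin p) (Fin p) ℂ)
    (hDU : IsMoorePenrose DU DUp) (hDV : IsMoorePenrose DV DVp)
    (Up Vp : Matrix (Fin n ⊕ Fin p) (Fin m ⊕ Fin p) ℂ)
    (hU : IsMoorePenrose (Matrix.fromBlocks AU BU CU DU) Up)
    (hV : IsMoorePenrose (Matrix.fromBlocks AV BV CV DV) Vp)
    (JUp JVp : Matrix (Fin n ⊕ Fin p) (Fin m ⊕ Fin p) ℂ)
    (hJU : IsMoorePenrose
      (Matrix.fromBlocks (AU - BU * DUp * CU) (BU * DUp) (-(DUp * CU)) DUp) JUp)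
    (hJV : IsMoorePenrose
      (Matrix.fromBlocks (AV - BV * DVp * CV) (BV * DVp) (-(DVp * CV)) DVp) JVp)
    (h1 : colSpace CUᴴ ≤ colSpace AUᴴ) (h2 : colSpace BU ≤ colSpace AU)
    (h3 : colSpace BUᴴ ≤ colSpace DUᴴ) (h4 : colSpace CU ≤ colSpace DU)
    (h5 : colSpace CVᴴ ≤ colSpace AVᴴ) (h6 : colSpace BV ≤ colSpace AV)
    (h7 : colSpace BVᴴ ≤ colSpace DVᴴ) (h8 : colSpace CV ≤ colSpace DV)
    (hrsU : colSpace DUᴴ = colSpace DU) (hrsV : colSpace DVᴴ = colSpace DV)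
    (habs : Up + Vp =
      Up * (Matrix.fromBlocks AU BU CU DU + Matrix.fromBlocks AV BV CV DV) * Vp) :
    JUp + JVp = JUp *
      (Matrix.fromBlocks (AU - BU * DUp * CU) (BU * DUp) (-(DUp * CU)) DUp +
        Matrix.fromBlocks (AV - BV * DVp * CV) (BV * DVp) (-(DVp * CV)) DVp) * JVp := by
  obtain ⟨LU, hLU⟩ := exists_eq_mul_of_colSpace_conjTranspose_le h1
  obtain ⟨KU, hKU⟩ := exists_eq_mul_of_colSpace_le h2
  obtain ⟨MU, hMU⟩ := exists_eq_mul_of_colSpace_conjTranspose_le h3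
  obtain ⟨LV, hLV⟩ := exists_eq_mul_of_colSpace_conjTranspose_le h5
  obtain ⟨KV, hKV⟩ := exists_eq_mul_of_colSpace_le h6
  obtain ⟨NV, hNV⟩ := exists_eq_mul_of_colSpace_le h8
  obtain ⟨hcol, hrow⟩ := (hU.absorbing_iff hV).1 habs
  rw [Matrix.mul_assoc, ← fromBlocks_toBlocks (Vp * _), fromBlocks_multiply,
    fromBlocks_inj] at hcol
  rw [← fromBlocks_toBlocks (fromBlocks AV BV CV DV * Up), fromBlocks_multiply,
    fromBlocks_inj] at hrow
  obtain ⟨hAc, -, -, hDc⟩ := hcol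
  obtain ⟨hAr, -, -, hDr⟩ := hrow
  generalize Vp * fromBlocks AU BU CU DU = Z at hAc hDc
  generalize fromBlocks AV BV CV DV * Up = W at hAr hDr
  obtain ⟨S, hS⟩ : ∃ S, AU = AV * S :=
    ⟨Z.toBlocks₁₁ + KV * Z.toBlocks₂₁, by
      rw [Matrix.mul_add, ← Matrix.mul_assoc, ← hKV, hAc]⟩
  obtain ⟨T, hT⟩ : ∃ T, DU = DV * T :=
    ⟨NV * Z.toBlocks₁₂ + Z.toBlocks₂₂, by
      rw [Matrix.mul_add, ← Matrix.mul_assoc, ← hNV, hDc]⟩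
  obtain ⟨S', hS'⟩ : ∃ S, AV = S * AU :=
    ⟨W.toBlocks₁₁ + W.toBlocks₁₂ * LU, by
      rw [Matrix.add_mul, Matrix.mul_assoc, ← hLU, hAr]⟩
  obtain ⟨T', hT'⟩ : ∃ T, DV = T * DU :=
    ⟨W.toBlocks₂₁ * MU + W.toBlocks₂₂, by
      rw [Matrix.add_mul, Matrix.mul_assoc, ← hMU, hDr]⟩
  obtain ⟨P, hP⟩ := hDU.exists_eq_mul_of_rangeSymmetric hDV hrsU hrsV hT
  obtain ⟨Q, hQ⟩ := hDV.conjTranspose.exists_eq_mul_of_rangeSymmetric hDU.conjTranspose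
    (by simpa using hrsV.symm) (by simpa using hrsU.symm)
    (T := T'ᴴ) (by rw [← conjTranspose_mul, ← hT'])
  replace hQ : DVp = Qᴴ * DUp := by simpa using congrArg Matrix.conjTranspose hQ
  have hdiagc : fromBlocks AU 0 0 DUp = fromBlocks AV 0 0 DVp * fromBlocks S 0 0 P := by
    simp [fromBlocks_multiply, ← hS, ← hP]
  have hdiagr : fromBlocks AV 0 0 DVp = fromBlocks S' 0 0 Qᴴ * fromBlocks AU 0 0 DUp := by
    simp [fromBlocks_multiply, ← hS', ← hQ]
  have hUc := pivot_eq_diag_mul AU DUp KU CU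
  have hVc := diag_eq_pivot_mul AV DVp KV CV
  have hVr := pivot_eq_mul_diag AV DVp BV LV
  have hUr := diag_eq_mul_pivot AU DUp BU LU
  rw [← hKU, hdiagc] at hUc
  rw [← hKV] at hVc
  rw [← hLV, hdiagr] at hVr
  rw [← hLU] at hUr
  rw [hVc] at hUc
  rw [hUr, ← Matrix.mul_assoc, ← Matrix.mul_assoc] at hVr
  exact hJU.absorbing_of_eq_mul hJV
    (hUc.trans ((Matrix.mul_assoc _ _ _).trans (Matrix.mul_assoc _ _ _))) hVr
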